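/- Let K be a field of characteristic zero and let M = (m_{i,j}) be a frieze matrix of size n over K. Then for all indices with 3 ≤ i ≤ n−1 and i ≤ j ≤ n, m_{i,j} = (m_{1,i} m_{2,j})/m_{1,2} + (m_{2,i} m_{1,j})/m_{1,2} − 2 ∑_{t=3}^{i} (m_{1,i} m_{1,j})/(m_{1,t} m_{1,t−1}) · m_{t−1,t}. -/

import Mathlib

/-- A frieze matrix of size `n` over a field `K`, represented as a function on
1-based indices `1,…,n`. -/
def IsFriezeMatrix {K : Type*} [Field K] (n : ℕ) (m : ℕ → ℕ → K) : Prop :=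
  (∀ i j, 1 ≤ i → i ≤ n → 1 ≤ j → j ≤ n → m i j = m j i) ∧
  (∀ i j, 1 ≤ i → i ≤ n → 1 ≤ j → j ≤ n → (m i j = 0 ↔ i = j)) ∧
  (∀ i j, 1 ≤ i → i + 1 ≤ j → j + 1 ≤ n →
    m i j * m (i + 1) (j + 1) - m (i + 1) j * m i (j + 1) = m i (i + 1) * m j (j + 1))

namespace IsFriezeMatrix

variable {K : Type*} [Field K] {n : ℕ} {m : ℕ → ℕ → K}

/-- Off-diagonal entries of a frieze matrix do not vanish. -/
theorem ne_zero (hM : IsFriezeMatrix n m) {i j : ℕ} (hi : 1 ≤ i) (hin : i ≤ n) (hj : 1 ≤ j)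
    (hjn : j ≤ n) (hij : i ≠ j) : m i j ≠ 0 :=
  fun h => hij ((hM.2.1 i j hi hin hj hjn).1 h)

/-- Diagonal entries of a frieze matrix vanish. -/
theorem diag_eq_zero (hM : IsFriezeMatrix n m) {i : ℕ} (hi : 1 ≤ i) (hin : i ≤ n) : m i i = 0 :=
  (hM.2.1 i i hi hin hi hin).2 rfl

/-- The Plücker relation for the first two rows: every entry on or above the diagonal, below the
first row, is determined by the first two rows. -/
theorem mul_entry_eq (hM : IsFriezeMatrix n m) {i j : ℕ} (hi : 2 ≤ i) (hij : i ≤ j)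
    (hjn : j ≤ n) : m 1 2 * m i j = m 1 i * m 2 j - m 2 i * m 1 j := by
  induction i, hi using Nat.le_induction generalizing j with
  | base => rw [hM.diag_eq_zero (by omega) (by omega)]; ring
  | succ i hi ih_row =>
    induction j, hij using Nat.le_induction with
    | base => rw [hM.diag_eq_zero (by omega) hjn]; ring
    | succ j hij ih =>
      have hd := hM.2.2 i j (by omega) hij hjn
      have hsup := hM.2.2 1 j le_rfl (by omega) hjn
      have hsup' := hM.2.2 1 i le_rfl (by omega) (by omega)
      have hleft := ih (by omega)
      have hup := ih_row (j := j + 1) (by omega) hjn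
      have hdiag := ih_row (j := j) (by omega) (by omega)
      norm_num at hsup hsup'
      have h12 : m 1 2 ≠ 0 := hM.ne_zero le_rfl (by omega) (by omega) (by omega) (by omega)
      have hij0 : m i j ≠ 0 :=
        hM.ne_zero (by omega) (by omega) (by omega) (by omega) (by omega)
      apply mul_left_cancel₀ (mul_ne_zero h12 hij0)
      calc m 1 2 * m i j * (m 1 2 * m (i + 1) (j + 1))
          = (m 1 2 * m i (i + 1)) * (m 1 2 * m j (j + 1)) +
              (m 1 2 * m (i + 1) j) * (m 1 2 * m i (j + 1)) := by
            linear_combination m 1 2 ^ 2 * hd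
        _ = m 1 2 * m i j * (m 1 (i + 1) * m 2 (j + 1) - m 2 (i + 1) * m 1 (j + 1)) := by
            rw [← hsup, ← hsup', hleft, hup, hdiag]; ring

/-- The sum of `m (t - 1) t / (m 1 t * m 1 (t - 1))` telescopes. -/
theorem sum_superdiag_div (hM : IsFriezeMatrix n m) {i : ℕ} (hi : 2 ≤ i) (hin : i ≤ n) :
    ∑ t ∈ Finset.Icc 3 i, m (t - 1) t / (m 1 t * m 1 (t - 1)) = m 2 i / (m 1 2 * m 1 i) := by
  induction i, hi using Nat.le_induction with
  | base => simp [hM.diag_eq_zero (i := 2) (by omega) hin]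
  | succ i hi ih =>
    have h12 : m 1 2 ≠ 0 := hM.ne_zero le_rfl (by omega) (by omega) (by omega) (by omega)
    have h1i : m 1 i ≠ 0 := hM.ne_zero le_rfl (by omega) (by omega) (by omega) (by omega)
    have h1i' : m 1 (i + 1) ≠ 0 := hM.ne_zero le_rfl (by omega) (by omega) hin (by omega)
    have hd := hM.mul_entry_eq hi (Nat.le_succ i) hin
    rw [Finset.sum_Icc_succ_top (by omega), ih (by omega), Nat.add_sub_cancel]
    field_simp
    linear_combination hd

end IsFriezeMatrix

/-- Proposition 8: an explicit formula for the entries of a frieze matrix in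
terms of its first two rows and the superdiagonal entries. -/
theorem friezeMatrix_entry_formula {K : Type*} [Field K] [CharZero K]
    (n : ℕ) (m : ℕ → ℕ → K) (hM : IsFriezeMatrix n m) :
    ∀ i j : ℕ, 3 ≤ i → i ≤ n - 1 → i ≤ j → j ≤ n →
      m i j = m 1 i * m 2 j / m 1 2 + m 2 i * m 1 j / m 1 2 -
        2 * ∑ t ∈ Finset.Icc 3 i, m 1 i * m 1 j / (m 1 t * m 1 (t - 1)) * m (t - 1) t := by
  intro i j hi hin hij hjn
  have h12 : m 1 2 ≠ 0 := hM.ne_zero le_rfl (by omega) (by omega) (by omega) (by omega)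
  have h1i : m 1 i ≠ 0 := hM.ne_zero le_rfl (by omega) (by omega) (by omega) (by omega)
  have hentry := hM.mul_entry_eq (by omega) hij hjn
  have hsum : ∑ t ∈ Finset.Icc 3 i, m 1 i * m 1 j / (m 1 t * m 1 (t - 1)) * m (t - 1) t =
      m 1 i * m 1 j * (m 2 i / (m 1 2 * m 1 i)) := by
    rw [← hM.sum_superdiag_div (by omega) (by omega), Finset.mul_sum]
    exact Finset.sum_congr rfl fun t _ => by ring
  rw [hsum]
  field_simp
  linear_combination hentry
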